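/- arXiv:2104.08776 — 2 statements merged into one kernel-verified Lean document; each statement's English description precedes it below -/
import Mathlib

section
/- (Theorem 1, precise form.) Let c be a positive integer and let (v_u)_{u ∈ U} be a finite family of sign vectors in ℝ^c whose pairwise Hamming distances are all at least d_min, where d_min > 0. Fix y ∈ U, let z ∈ ℝ^c satisfy ‖z‖ = √c, and define ℓ_pos(z) = max(0, 1 − (1/c)⟨v_y, z⟩) and ℓ_neg(z) = max_{u ∈ U, u ≠ y} (1/c)⟨v_u, z⟩ (assuming U has at least two elements). If ℓ_pos(z) = 0, then ℓ_neg(z) = max_{u ≠ y} (1/c)⟨v_u, v_y⟩ ≤ 1 − 2·d_min/c. -/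
open scoped RealInnerProductSpace

/-- The inner product of two sign vectors is the dimension minus twice their Hamming distance. -/
theorem inner_eq_sub_two_mul_card_ne {ι : Type*} [Fintype ι] (v w : EuclideanSpace ℝ ι)
    (hv : ∀ i, v i = 1 ∨ v i = -1) (hw : ∀ i, w i = 1 ∨ w i = -1) :
    ⟪v, w⟫ = Fintype.card ι - 2 * ((Finset.univ.filter fun i => v i ≠ w i).card : ℝ) := by
  have hterm : ∀ i, ⟪v i, w i⟫ = 1 - 2 * (if v i ≠ w i then (1 : ℝ) else 0) := by
    intro i
    rcases hv i with h | h <;> rcases hw i with h' | h' <;> rw [h, h'] <;> norm_num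
  rw [PiLp.inner_apply, Finset.sum_congr rfl fun i _ => hterm i, Finset.sum_sub_distrib,
    ← Finset.mul_sum, Finset.sum_boole]
  simp

/-- Two vectors of squared norm at most `r` whose inner product is at least `r` are equal. -/
theorem eq_of_norm_sq_le_of_le_inner {E : Type*} [NormedAddCommGroup E] [InnerProductSpace ℝ E]
    {x y : E} {r : ℝ} (hx : ‖x‖ ^ 2 ≤ r) (hy : ‖y‖ ^ 2 ≤ r) (h : r ≤ ⟪x, y⟫) : x = y := by
  have hsq := norm_sub_sq_real x y
  rw [← sub_eq_zero, ← norm_eq_zero]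
  exact pow_eq_zero_iff two_ne_zero |>.mp (le_antisymm (by linarith) (sq_nonneg _))

/-- Theorem 1, precise form: For a finite family (with at least two
elements) of sign vectors in `ℝ^c` with pairwise Hamming distances at least
`d_min > 0`, a fixed index `y`, and `z` with `‖z‖ = √c`: if
`ℓ_pos(z) = max(0, 1 - (1/c)⟨v_y, z⟩) = 0`, then
`ℓ_neg(z) = max_{u ≠ y} (1/c)⟨v_u, z⟩ = max_{u ≠ y} (1/c)⟨v_u, v_y⟩ ≤ 1 - 2 d_min / c`. -/
theorem neg_loss_of_pos_loss_eq_zero (c : ℕ) (hc : 0 < c)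
    (U : Type*) [Fintype U] [DecidableEq U] (hU : Nontrivial U)
    (v : U → EuclideanSpace ℝ (Fin c))
    (hv : ∀ u i, v u i = 1 ∨ v u i = -1)
    (dmin : ℝ) (hdmin : 0 < dmin)
    (hdist : ∀ u₁ u₂ : U, u₁ ≠ u₂ →
        dmin ≤ ((Finset.univ.filter fun i => v u₁ i ≠ v u₂ i).card : ℝ))
    (y : U) (z : EuclideanSpace ℝ (Fin c))
    (hz : ‖z‖ = Real.sqrt c)
    (hpos : max 0 (1 - (1 / c : ℝ) * ⟪v y, z⟫) = 0) :
    (Finset.univ.erase y).sup'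
        ((Finset.erase_nonempty (Finset.mem_univ y)).mpr Finset.univ_nontrivial)
        (fun u => (1 / c : ℝ) * ⟪v u, z⟫) =
      (Finset.univ.erase y).sup'
        ((Finset.erase_nonempty (Finset.mem_univ y)).mpr Finset.univ_nontrivial)
        (fun u => (1 / c : ℝ) * ⟪v u, v y⟫) ∧
    (Finset.univ.erase y).sup'
        ((Finset.erase_nonempty (Finset.mem_univ y)).mpr Finset.univ_nontrivial)
        (fun u => (1 / c : ℝ) * ⟪v u, z⟫) ≤ 1 - 2 * dmin / c := by
  have hc' : (0 : ℝ) < c := Nat.cast_pos.mpr hc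
  have hnorm : ‖v y‖ ^ 2 = c := by
    rw [← real_inner_self_eq_norm_sq, inner_eq_sub_two_mul_card_ne _ _ (hv y) (hv y)]
    simp
  have hinner : (c : ℝ) ≤ ⟪v y, z⟫ := by
    have h : 1 - (1 / c : ℝ) * ⟪v y, z⟫ ≤ 0 := hpos ▸ le_max_right _ _
    rwa [sub_nonpos, one_div_mul_eq_div, one_le_div hc'] at h
  have hzy : v y = z :=
    eq_of_norm_sq_le_of_le_inner hnorm.le (by rw [hz, Real.sq_sqrt hc'.le]) hinner
  subst hzy
  refine ⟨rfl, Finset.sup'_le _ _ fun u hu => ?_⟩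
  have hd := hdist u y (Finset.ne_of_mem_erase hu)
  rw [inner_eq_sub_two_mul_card_ne _ _ (hv u) (hv y), Fintype.card_fin, one_div_mul_eq_div,
    sub_div, div_self hc'.ne']
  gcongr
end

section
/- (Quantitative version of Theorem 1: the effect of the negative loss vanishes as the positive loss becomes small.) Let c be a positive integer and let (v_u)_{u ∈ U} be a finite family of sign vectors in ℝ^c, with at least two elements, whose pairwise Hamming distances are all at least d_min > 0. Fix y ∈ U, let z ∈ ℝ^c satisfy ‖z‖ = √c, and let ε ≥ 0. Define ℓ_pos(z) = max(0, 1 − (1/c)⟨v_y, z⟩) and ℓ_neg(z) = max_{u ≠ y} (1/c)⟨v_u, z⟩. If ℓ_pos(z) ≤ ε, then ℓ_neg(z) ≤ 1 − 2·d_min/c + √(2ε). -/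
open scoped RealInnerProductSpace

/-- A sign vector in `ℝ^c` has norm `√c`. -/
theorem norm_eq_sqrt_of_sign {c : ℕ} {a : EuclideanSpace ℝ (Fin c)}
    (ha : ∀ i, a i = 1 ∨ a i = -1) : ‖a‖ = Real.sqrt c := by
  rw [EuclideanSpace.norm_eq]
  have h : ∀ i, ‖a i‖ ^ 2 = 1 := fun i => by
    rcases ha i with h | h <;> simp [h]
  simp only [h, Finset.sum_const, Finset.card_univ, Fintype.card_fin, nsmul_eq_mul, mul_one]

/-- The inner product of two sign vectors is `c` minus twice their Hamming distance. -/
theorem inner_eq_sub_two_mul_card_ne_of_sign {c : ℕ} {a b : EuclideanSpace ℝ (Fin c)}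
    (ha : ∀ i, a i = 1 ∨ a i = -1) (hb : ∀ i, b i = 1 ∨ b i = -1) :
    ⟪a, b⟫ = (c : ℝ) - 2 * ((Finset.univ.filter fun i => a i ≠ b i).card : ℝ) := by
  have h : ∀ i, ⟪a i, b i⟫ = 1 - 2 * (if a i ≠ b i then (1 : ℝ) else 0) := fun i => by
    rcases ha i with h | h <;> rcases hb i with h' | h' <;> norm_num [h, h']
  rw [PiLp.inner_apply, Finset.sum_congr rfl fun i _ => h i, Finset.sum_sub_distrib,
    ← Finset.mul_sum, Finset.sum_boole]
  simp

/-- Two vectors of norm `√c` whose normalized inner product is at least `1 - ε` are at distance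
at most `√c * √(2ε)`. -/
theorem norm_sub_le_of_one_sub_inner_le {E : Type*} [NormedAddCommGroup E]
    [InnerProductSpace ℝ E] {c ε : ℝ} (hc : 0 < c) {a z : E}
    (ha : ‖a‖ = Real.sqrt c) (hz : ‖z‖ = Real.sqrt c)
    (h : 1 - (1 / c) * ⟪a, z⟫ ≤ ε) : ‖z - a‖ ≤ Real.sqrt c * Real.sqrt (2 * ε) := by
  rw [← Real.sqrt_mul hc.le]
  apply Real.le_sqrt_of_sq_le
  rw [norm_sub_sq_real, ha, hz, Real.sq_sqrt hc.le, real_inner_comm]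
  have h' := mul_le_mul_of_nonneg_left h hc.le
  have e : c * (1 - (1 / c) * ⟪a, z⟫) = c - ⟪a, z⟫ := by field_simp
  linarith

/-- Quantitative Theorem 1: For a finite family (with at least two
elements) of sign vectors in `ℝ^c` with pairwise Hamming distances at least
`d_min > 0`, a fixed index `y`, `z` with `‖z‖ = √c`, and `ε ≥ 0`: if
`ℓ_pos(z) = max(0, 1 - (1/c)⟨v_y, z⟩) ≤ ε`, then
`ℓ_neg(z) = max_{u ≠ y} (1/c)⟨v_u, z⟩ ≤ 1 - 2 d_min / c + √(2ε)`. -/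
theorem neg_loss_le_of_pos_loss_le (c : ℕ) (hc : 0 < c)
    (U : Type*) [Fintype U] [DecidableEq U] (hU : Nontrivial U)
    (v : U → EuclideanSpace ℝ (Fin c))
    (hv : ∀ u i, v u i = 1 ∨ v u i = -1)
    (dmin : ℝ) (hdmin : 0 < dmin)
    (hdist : ∀ u₁ u₂ : U, u₁ ≠ u₂ →
        dmin ≤ ((Finset.univ.filter fun i => v u₁ i ≠ v u₂ i).card : ℝ))
    (y : U) (z : EuclideanSpace ℝ (Fin c))
    (hz : ‖z‖ = Real.sqrt c)
    (ε : ℝ) (hε : 0 ≤ ε)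
    (hpos : max 0 (1 - (1 / c : ℝ) * ⟪v y, z⟫) ≤ ε) :
    (Finset.univ.erase y).sup'
        ((Finset.erase_nonempty (Finset.mem_univ y)).mpr Finset.univ_nontrivial)
        (fun u => (1 / c : ℝ) * ⟪v u, z⟫) ≤
      1 - 2 * dmin / c + Real.sqrt (2 * ε) := by
  have hc' : (0 : ℝ) < c := Nat.cast_pos.mpr hc
  refine Finset.sup'_le _ _ fun u hu => ?_
  have hd := hdist u y (Finset.ne_of_mem_erase hu)
  have hcs : ⟪v u, z - v y⟫ ≤ c * Real.sqrt (2 * ε) := by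
    calc ⟪v u, z - v y⟫ ≤ ‖v u‖ * ‖z - v y‖ := real_inner_le_norm _ _
      _ ≤ Real.sqrt c * (Real.sqrt c * Real.sqrt (2 * ε)) := by
        rw [norm_eq_sqrt_of_sign (hv u)]
        gcongr
        exact norm_sub_le_of_one_sub_inner_le hc' (norm_eq_sqrt_of_sign (hv y)) hz
          ((le_max_right _ _).trans hpos)
      _ = c * Real.sqrt (2 * ε) := by rw [← mul_assoc, Real.mul_self_sqrt hc'.le]
  rw [inner_sub_right, inner_eq_sub_two_mul_card_ne_of_sign (hv u) (hv y)] at hcs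
  calc (1 / c : ℝ) * ⟪v u, z⟫ ≤ (1 / c : ℝ) * (c - 2 * dmin + c * Real.sqrt (2 * ε)) := by
        gcongr
        linarith
    _ = 1 - 2 * dmin / c + Real.sqrt (2 * ε) := by field_simp
end
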